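/- (Theorem 5, one-step contraction) Let each f_{n,i} be differentiable, μ-strongly convex, with L-Lipschitz gradient, let the weight matrices satisfy Assumption 1, let q_min = min_n q_n and q_max = max_n q_n, and let γ be the smallest eigenvalue of Z̃. Choose η > L² q_max/(μ q_min) + L²/μ − L, stepsize α ∈ (0, γ/(2η)), and c ∈ (4αL q_max/η, 4αμ q_min/L − 2α q_min(2L−μ)/η). Fix x, v ∈ ℝ^{Np} with v and v* in the column space of U, and a table y, and for each joint index i define x⁺(i) = x − α ĝ(i) − (I−Z̃)x − U v, v⁺(i) = v + U x⁺(i), and y⁺(i) the table with y⁺(i)_{n,j} = x_n if j = i_n and y_{n,j} otherwise. Then there exists δ ∈ (0,1) (depending only on μ, L, α, η, c, q_min, q_max, and the spectra of Z̃, Z̃−Z, and I+Z−2Z̃, but not on x, v, y) such that E_i[‖u⁺(i) − u*‖²_G + c · p(y⁺(i))] ≤ (1 − δ)(‖u − u*‖²_G + c · p(y)). -/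

import Mathlib

open Finset
open scoped RealInnerProductSpace

noncomputable section

/-- Block vectors of `ℝ^{Np}`: one vector of `ℝᵖ` per node. -/
abbrev Evec (p : ℕ) := EuclideanSpace ℝ (Fin p)

/-- The local objective of node `n`: `f_n(w) = (1/q_n) ∑_i f_{n,i}(w)`. -/
def locf {N p : ℕ} {q : Fin N → ℕ}
    (f : (n : Fin N) → Fin (q n) → Evec p → ℝ) (n : Fin N) (w : Evec p) : ℝ :=
  (q n : ℝ)⁻¹ * ∑ i, f n i w

/-- The local stochastic averaging gradient of node `n` for index choice `j`:
`ĝ_n(j) = ∇f_{n,j}(x_n) − ∇f_{n,j}(y_{n,j}) + (1/q_n) ∑_i ∇f_{n,i}(y_{n,i})`. -/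
def hatg {N p : ℕ} {q : Fin N → ℕ}
    (f : (n : Fin N) → Fin (q n) → Evec p → ℝ)
    (x : Fin N → Evec p)
    (y : (n : Fin N) → Fin (q n) → Evec p)
    (n : Fin N) (j : Fin (q n)) : Evec p :=
  gradient (f n j) (x n) - gradient (f n j) (y n j)
    + (q n : ℝ)⁻¹ • ∑ i, gradient (f n i) (y n i)

/-- `p(y) = ∑_n (1/q_n) ∑_i [f_{n,i}(y_{n,i}) − f_{n,i}(x̃*) − ⟨∇f_{n,i}(x̃*), y_{n,i} − x̃*⟩]`. -/
def ptbl {N p : ℕ} {q : Fin N → ℕ}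
    (f : (n : Fin N) → Fin (q n) → Evec p → ℝ)
    (xstar : Evec p)
    (y : (n : Fin N) → Fin (q n) → Evec p) : ℝ :=
  ∑ n, (q n : ℝ)⁻¹ * ∑ i,
    (f n i (y n i) - f n i xstar - ⟪gradient (f n i) xstar, y n i - xstar⟫)

/-- The aggregate optimality gap `f(x) − f(x*) − ⟨∇f(x*), x − x*⟩`, written blockwise. -/
def optgap {N p : ℕ} {q : Fin N → ℕ}
    (f : (n : Fin N) → Fin (q n) → Evec p → ℝ)
    (xstar : Evec p) (x : Fin N → Evec p) : ℝ :=
  ∑ n, (locf f n (x n) - locf f n xstar - ⟪gradient (locf f n) xstar, x n - xstar⟫)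

/-- The quadratic form `aᵀ (M ⊗ I_p) a` of an extended weight matrix, written blockwise. -/
def quadForm {N p : ℕ} (M : Matrix (Fin N) (Fin N) ℝ) (a : Fin N → Evec p) : ℝ :=
  ∑ n, ⟪a n, ∑ m, M n m • a m⟫

/-- The squared Euclidean norm of a block vector of `ℝ^{Np}`. -/
def sqnormB {N p : ℕ} (a : Fin N → Evec p) : ℝ := ∑ n, ‖a n‖^2

/-- The gradient table obtained from `y` by replacing, at each node `n`, the entry
`i n` by the current iterate `x n`. -/
def tblUpd {N p : ℕ} {q : Fin N → ℕ}
    (x : Fin N → Evec p)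
    (y : (n : Fin N) → Fin (q n) → Evec p)
    (i : (n : Fin N) → Fin (q n)) : (n : Fin N) → Fin (q n) → Evec p :=
  fun n => Function.update (y n) (i n) (x n)

end

section Bregman

variable {E : Type*} [NormedAddCommGroup E] [InnerProductSpace ℝ E] [CompleteSpace E]

/-- The Bregman divergence of a differentiable function. -/
noncomputable def bregman (g : E → ℝ) (a b : E) : ℝ := g a - g b - ⟪gradient g b, a - b⟫

theorem hasDerivAt_comp_line {g : E → ℝ} (hg : Differentiable ℝ g) (b d : E) (t : ℝ) :
    HasDerivAt (fun s : ℝ => g (b + s • d)) ⟪gradient g (b + t • d), d⟫ t := by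
  have h := (hg (b + t • d)).hasGradientAt.hasFDerivAt.comp_hasDerivAt t
    (((hasDerivAt_id t).smul_const d).const_add b)
  convert! h using 1
  simp

theorem StrongConvexOn.le_bregman {g : E → ℝ} {μ : ℝ} (hg : Differentiable ℝ g)
    (hsc : StrongConvexOn Set.univ μ g) (a b : E) : μ / 2 * ‖a - b‖ ^ 2 ≤ bregman g a b := by
  rw [strongConvexOn_iff_convex] at hsc
  have hline := hsc.comp_affineMap (AffineMap.lineMap b a : ℝ →ᵃ[ℝ] E)
  have hd : HasDerivAt (fun s : ℝ => g (b + s • (a - b)) - μ / 2 * ‖b + s • (a - b)‖ ^ 2)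
      (⟪gradient g b, a - b⟫ - μ * ⟪b, a - b⟫) 0 := by
    have h1 := hasDerivAt_comp_line hg b (a - b) 0
    have h2 := ((((hasDerivAt_id (0 : ℝ)).smul_const (a - b)).const_add b).norm_sq).const_mul
      (μ / 2)
    convert! h1.sub h2 using 1
    simp
    ring
  have hfun : ((fun x => g x - μ / 2 * ‖x‖ ^ 2) ∘ (AffineMap.lineMap b a : ℝ →ᵃ[ℝ] E)) =
      fun s : ℝ => g (b + s • (a - b)) - μ / 2 * ‖b + s • (a - b)‖ ^ 2 := by
    funext s
    simp [AffineMap.lineMap_apply, add_comm]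
  rw [hfun] at hline
  have hs := hline.le_slope_of_hasDerivAt (x := 0) (y := 1) (by simp) (by simp) one_pos hd
  have hn : ‖a - b‖ ^ 2 = ‖a‖ ^ 2 - ‖b‖ ^ 2 - 2 * ⟪b, a - b⟫ := by
    rw [norm_sub_sq_real, inner_sub_right, real_inner_self_eq_norm_sq, real_inner_comm]
    ring
  simp [slope_def_field, -inner_gradient_left] at hs
  rw [bregman, hn]
  linarith

theorem bregman_le_of_lipschitz_gradient {g : E → ℝ} {L : ℝ} (hg : Differentiable ℝ g)
    (hlip : ∀ a b, ‖gradient g a - gradient g b‖ ≤ L * ‖a - b‖) (a b : E) :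
    bregman g a b ≤ L / 2 * ‖a - b‖ ^ 2 := by
  have hd (t : ℝ) : HasDerivAt (fun s : ℝ => g (b + s • (a - b)) - s * ⟪gradient g b, a - b⟫
        - s ^ 2 * (L / 2 * ‖a - b‖ ^ 2))
      (⟪gradient g (b + t • (a - b)), a - b⟫ - ⟪gradient g b, a - b⟫ - t * (L * ‖a - b‖ ^ 2)) t := by
    convert! ((hasDerivAt_comp_line hg b (a - b) t).sub
      ((hasDerivAt_id t).mul_const ⟪gradient g b, a - b⟫)).sub
      (((hasDerivAt_id t).pow 2).mul_const (L / 2 * ‖a - b‖ ^ 2)) using 1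
    simp
    ring
  have hanti : AntitoneOn (fun s : ℝ => g (b + s • (a - b)) - s * ⟪gradient g b, a - b⟫
        - s ^ 2 * (L / 2 * ‖a - b‖ ^ 2)) (Set.Icc 0 1) := by
    refine antitoneOn_of_deriv_nonpos (convex_Icc 0 1)
      (fun t _ => (hd t).continuousAt.continuousWithinAt)
      (fun t _ => (hd t).differentiableAt.differentiableWithinAt) fun t ht => ?_
    rw [interior_Icc] at ht
    rw [(hd t).deriv, ← inner_sub_left, sub_nonpos]
    refine (real_inner_le_norm _ _).trans ?_
    have h := hlip (b + t • (a - b)) b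
    rw [add_sub_cancel_left, norm_smul, Real.norm_of_nonneg ht.1.le] at h
    calc _ ≤ L * (t * ‖a - b‖) * ‖a - b‖ := by gcongr
      _ = _ := by ring
  have h := hanti (Set.left_mem_Icc.2 zero_le_one) (Set.right_mem_Icc.2 zero_le_one) zero_le_one
  simp [-inner_gradient_left] at h
  rw [bregman]
  linarith

theorem inner_gradient_sub_gradient (g : E → ℝ) (a b : E) :
    ⟪gradient g a - gradient g b, a - b⟫ = bregman g a b + bregman g b a := by
  have h : ⟪gradient g a, b - a⟫ = -⟪gradient g a, a - b⟫ := by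
    rw [← inner_neg_right, neg_sub]
  rw [bregman, bregman, inner_sub_left, h]
  ring

theorem norm_gradient_sub_sq_le {g : E → ℝ} {L : ℝ} (hL : 0 < L) (hg : Differentiable ℝ g)
    (hnonneg : ∀ a b, 0 ≤ bregman g a b)
    (hlip : ∀ a b, ‖gradient g a - gradient g b‖ ≤ L * ‖a - b‖) (a b : E) :
    ‖gradient g a - gradient g b‖ ^ 2 ≤ 2 * L * bregman g a b := by
  set Δ := gradient g a - gradient g b with hΔ
  have h1 := hnonneg (a - L⁻¹ • Δ) b
  have h2 := bregman_le_of_lipschitz_gradient hg hlip (a - L⁻¹ • Δ) a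
  have h3 : bregman g (a - L⁻¹ • Δ) b
      = bregman g (a - L⁻¹ • Δ) a + bregman g a b - L⁻¹ * ‖Δ‖ ^ 2 := by
    have : ‖Δ‖ ^ 2 = ⟪gradient g a, Δ⟫ - ⟪gradient g b, Δ⟫ := by
      rw [← inner_sub_left, ← hΔ, real_inner_self_eq_norm_sq]
    simp only [bregman, this, inner_sub_right, inner_smul_right]
    ring
  rw [sub_sub_cancel_left, norm_neg, norm_smul, Real.norm_of_nonneg (by positivity)] at h2
  have h4 : L / 2 * (L⁻¹ * ‖Δ‖) ^ 2 = L⁻¹ * ‖Δ‖ ^ 2 / 2 := by field_simp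
  have h5 : L⁻¹ * ‖Δ‖ ^ 2 ≤ 2 * bregman g a b := by linarith
  rw [inv_mul_le_iff₀ hL] at h5
  linarith

end Bregman

theorem norm_add_add_sq_le {H : Type*} [SeminormedAddCommGroup H] (a b c : H) :
    ‖a + b + c‖ ^ 2 ≤ 3 * (‖a‖ ^ 2 + ‖b‖ ^ 2 + ‖c‖ ^ 2) := by
  have h := norm_add₃_le (a := a) (b := b) (c := c)
  nlinarith [norm_nonneg (a + b + c), sq_nonneg (‖a‖ - ‖b‖), sq_nonneg (‖b‖ - ‖c‖),
    sq_nonneg (‖a‖ - ‖c‖), norm_nonneg a, norm_nonneg b, norm_nonneg c]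

section SaddlePointStep

variable {H : Type*} [NormedAddCommGroup H] [InnerProductSpace ℝ H]

theorem saddle_step_identity {T U : H →L[ℝ] H} (hT : ∀ a b, ⟪T a, b⟫ = ⟪a, T b⟫)
    (hU : ∀ a b, ⟪U a, b⟫ = ⟪a, U b⟫) {α : ℝ} {e k g d h : H}
    (hd : d = T e - α • g - U k) (hh : h = k + U d) :
    ⟪d, T d⟫ + ‖h‖ ^ 2 = ⟪e, T e⟫ + ‖k‖ ^ 2 - 2 * α * ⟪d, g⟫ - 2 * ⟪d, d - T d - U (U d)⟫
      - ⟪d - e, T (d - e)⟫ - ‖U d‖ ^ 2 := by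
  have h1 : ⟪d, d⟫ = ⟪d, T e⟫ - α * ⟪d, g⟫ - ⟪d, U k⟫ := by
    rw [← inner_smul_right, ← inner_sub_right, ← inner_sub_right, ← hd]
  have h2 : ‖h‖ ^ 2 = ‖k‖ ^ 2 + 2 * ⟪d, U k⟫ + ‖U d‖ ^ 2 := by
    rw [hh, norm_add_sq_real, ← hU d k, real_inner_comm]
  have h3 : ⟪d, U (U d)⟫ = ‖U d‖ ^ 2 := by rw [← hU, real_inner_self_eq_norm_sq]
  have h4 : ⟪e, T d⟫ = ⟪d, T e⟫ := by rw [← hT, real_inner_comm]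
  simp only [map_sub, inner_sub_left, inner_sub_right, h2, h3, h4]
  linarith

theorem exists_norm_sq_le_of_mem_range [FiniteDimensional ℝ H] {U : H →L[ℝ] H}
    (hU : ∀ a b, ⟪U a, b⟫ = ⟪a, U b⟫) :
    ∃ C : ℝ, 0 ≤ C ∧ ∀ a, ‖U a‖ ^ 2 ≤ C * ‖U (U a)‖ ^ 2 := by
  set S := LinearMap.range U.toLinearMap
  have hker : LinearMap.ker (U.toLinearMap.domRestrict S) = ⊥ := by
    rw [LinearMap.ker_eq_bot']
    rintro ⟨_, a, rfl⟩ ha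
    have h0 : U (U a) = 0 := ha
    have h1 : ⟪U a, U a⟫ = 0 := by rw [hU, h0, inner_zero_right]
    exact Subtype.ext (inner_self_eq_zero.1 h1)
  obtain ⟨K, -, hK⟩ := LinearMap.exists_antilipschitzWith _ hker
  refine ⟨(K : ℝ) ^ 2, by positivity, fun a => ?_⟩
  have h := hK.le_mul_dist ⟨U a, a, rfl⟩ 0
  rw [map_zero, dist_zero_right, dist_zero_right] at h
  rw [← mul_pow]
  exact pow_le_pow_left₀ (norm_nonneg _) h 2

/-- One step of the inexact saddle-point recursion decreases the energy up to the gradient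
noise; the constants depend only on the operators and the step size. -/
theorem exists_saddle_step_le [FiniteDimensional ℝ H] {T U : H →L[ℝ] H}
    (hT : ∀ a b, ⟪T a, b⟫ = ⟪a, T b⟫) (hU : ∀ a b, ⟪U a, b⟫ = ⟪a, U b⟫)
    (hR : ∀ a, 0 ≤ ⟪a, a - T a - U (U a)⟫) {γ α η : ℝ} (hγ : ∀ a, γ * ‖a‖ ^ 2 ≤ ⟪a, T a⟫)
    (hα : 0 < α) (hη : 0 < η) :
    ∃ A B K : ℝ, 0 ≤ B ∧ 0 ≤ K ∧ ∀ δ : ℝ, 0 ≤ δ → δ * A ≤ γ - α * η → ∀ e k g d h : H, (∃ a, k = U a) →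
      d = T e - α • g - U k → h = k + U d →
      ⟪d, T d⟫ + ‖h‖ ^ 2 ≤ (1 - δ) * (⟪e, T e⟫ + ‖k‖ ^ 2) - 2 * α * ⟪e, g⟫
        + (α / η + δ * K) * ‖g‖ ^ 2 + δ * B * ‖e‖ ^ 2 := by
  obtain ⟨C, hC, hCU⟩ := exists_norm_sq_le_of_mem_range hU
  refine ⟨3 * C, ‖T‖ + 3 * C * ‖T - 1‖ ^ 2, 3 * C * α ^ 2, by positivity, by positivity,
    ?_⟩
  rintro δ hδ hδA e k g d h ⟨a, rfl⟩ hd hh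
  have hid := saddle_step_identity hT hU hd hh
  have hk : ‖U a‖ ^ 2
      ≤ C * (3 * (‖T - 1‖ ^ 2 * ‖e‖ ^ 2 + ‖d - e‖ ^ 2 + α ^ 2 * ‖g‖ ^ 2)) := by
    refine (hCU a).trans (mul_le_mul_of_nonneg_left ?_ hC)
    have hUk : U (U a) = (T - 1) e + -(d - e) + -(α • g) := by
      rw [hd, sub_apply, one_apply_eq_self]
      abel
    rw [hUk]
    refine (norm_add_add_sq_le _ _ _).trans ?_
    have h1 := pow_le_pow_left₀ (norm_nonneg _) ((T - 1).le_opNorm e) 2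
    rw [mul_pow] at h1
    rw [norm_neg, norm_neg, norm_smul, mul_pow, Real.norm_eq_abs, sq_abs]
    linarith
  have he : ⟪e, T e⟫ ≤ ‖T‖ * ‖e‖ ^ 2 := by
    refine (real_inner_le_norm _ _).trans ?_
    nlinarith [T.le_opNorm e, norm_nonneg e]
  have hyoung : -(2 * α * ⟪d, g⟫) ≤ -(2 * α * ⟪e, g⟫) + α * η * ‖d - e‖ ^ 2 + α / η * ‖g‖ ^ 2 := by
    have h1 : 0 ≤ ‖η • (d - e) + g‖ ^ 2 := by positivity
    rw [norm_add_sq_real, norm_smul, mul_pow, Real.norm_eq_abs, sq_abs, inner_smul_left,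
      inner_sub_left] at h1
    have h2 := mul_nonneg (div_pos hα hη).le h1
    have h3 : α / η * (η ^ 2 * ‖d - e‖ ^ 2 + 2 * ((starRingEnd ℝ) η * (⟪d, g⟫ - ⟪e, g⟫)) + ‖g‖ ^ 2)
        = α * η * ‖d - e‖ ^ 2 + 2 * α * (⟪d, g⟫ - ⟪e, g⟫) + α / η * ‖g‖ ^ 2 := by
      simp
      field_simp
    linarith
  have hV := mul_le_mul_of_nonneg_left (add_le_add he hk) hδ
  have hr := mul_le_mul_of_nonneg_right hδA (sq_nonneg ‖d - e‖)
  have h5 := hR d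
  have h6 := hγ (d - e)
  have h7 := sq_nonneg ‖U d‖
  linear_combination hid + hV + hyoung + hr + 2 * h5 + h6 + h7

end SaddlePointStep

theorem Matrix.PosSemidef.isSymm {ι : Type*} {M : Matrix ι ι ℝ} (hM : M.PosSemidef) :
    M.IsSymm := by
  have h := hM.isHermitian
  rwa [Matrix.IsHermitian, Matrix.conjTranspose_eq_transpose_of_trivial] at h

section BlockOperator

variable {ι E : Type*} [Fintype ι] [NormedAddCommGroup E] [InnerProductSpace ℝ E]
  [FiniteDimensional ℝ E]

/-- The operator `M ⊗ I` on block vectors. -/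
noncomputable def blockOp (M : Matrix ι ι ℝ) :
    PiLp 2 (fun _ : ι => E) →L[ℝ] PiLp 2 (fun _ : ι => E) :=
  LinearMap.toContinuousLinearMap
    { toFun := fun a => WithLp.toLp 2 fun n => ∑ m, M n m • a m
      map_add' := fun a b => by
        ext n
        simp [Finset.sum_add_distrib]
      map_smul' := fun r a => by
        ext n
        simp [Finset.smul_sum, smul_comm r] }

@[simp]
theorem blockOp_apply (M : Matrix ι ι ℝ) (a : PiLp 2 (fun _ : ι => E)) (n : ι) :
    blockOp M a n = ∑ m, M n m • a m := rfl

theorem blockOp_mul (A B : Matrix ι ι ℝ) (a : PiLp 2 (fun _ : ι => E)) :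
    blockOp (A * B) a = blockOp A (blockOp B a) := by
  ext n
  simp only [blockOp_apply, Matrix.mul_apply, Finset.smul_sum, Finset.sum_smul, smul_smul]
  exact Finset.sum_comm

theorem blockOp_sub (A B : Matrix ι ι ℝ) (a : PiLp 2 (fun _ : ι => E)) :
    blockOp (A - B) a = blockOp A a - blockOp B a := by
  ext n
  simp [sub_smul, Finset.sum_sub_distrib]

theorem blockOp_one [DecidableEq ι] (a : PiLp 2 (fun _ : ι => E)) : blockOp 1 a = a := by
  ext n
  simp [Matrix.one_apply]

theorem inner_blockOp_left (M : Matrix ι ι ℝ) (a b : PiLp 2 (fun _ : ι => E)) :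
    ⟪blockOp M a, b⟫ = ⟪a, blockOp M.transpose b⟫ := by
  simp only [PiLp.inner_apply, blockOp_apply, sum_inner, inner_sum, real_inner_smul_left,
    real_inner_smul_right, Matrix.transpose_apply]
  exact Finset.sum_comm

theorem Matrix.IsSymm.inner_blockOp {M : Matrix ι ι ℝ} (hM : M.IsSymm)
    (a b : PiLp 2 (fun _ : ι => E)) : ⟪blockOp M a, b⟫ = ⟪a, blockOp M b⟫ := by
  rw [inner_blockOp_left, hM]

open scoped MatrixOrder Matrix.Norms.L2Operator in
theorem Matrix.PosSemidef.inner_blockOp_nonneg {M : Matrix ι ι ℝ} (hM : M.PosSemidef)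
    (a : PiLp 2 (fun _ : ι => E)) : 0 ≤ ⟪a, blockOp M a⟫ := by
  classical
  obtain ⟨B, rfl⟩ := CStarAlgebra.nonneg_iff_eq_star_mul_self.1 hM.nonneg
  rw [blockOp_mul, Matrix.star_eq_conjTranspose, Matrix.conjTranspose_eq_transpose_of_trivial, ← inner_blockOp_left]
  exact real_inner_self_nonneg

/-- The saddle-point step estimate for weight matrices `Wt` and `Us` acting on block vectors. -/
theorem exists_blockOp_step_le [DecidableEq ι] {Wt Us : Matrix ι ι ℝ} (hWt : Wt.IsSymm)
    (hUs : Us.IsSymm) (hR : (1 - Wt - Us * Us).PosSemidef) {γ α η : ℝ}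
    (hγ : ∀ a : PiLp 2 (fun _ : ι => E), γ * ‖a‖ ^ 2 ≤ ⟪a, blockOp Wt a⟫)
    (hα : 0 < α) (hη : 0 < η) :
    ∃ A B K : ℝ, 0 ≤ B ∧ 0 ≤ K ∧ ∀ δ : ℝ, 0 ≤ δ → δ * A ≤ γ - α * η →
      ∀ e k g d h : PiLp 2 (fun _ : ι => E), (∃ a, k = blockOp Us a) →
      d = blockOp Wt e - α • g - blockOp Us k → h = k + blockOp Us d →
      ⟪d, blockOp Wt d⟫ + ‖h‖ ^ 2 ≤ (1 - δ) * (⟪e, blockOp Wt e⟫ + ‖k‖ ^ 2) - 2 * α * ⟪e, g⟫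
        + (α / η + δ * K) * ‖g‖ ^ 2 + δ * B * ‖e‖ ^ 2 :=
  exists_saddle_step_le hWt.inner_blockOp hUs.inner_blockOp
    (fun a => by
      simpa only [blockOp_sub, blockOp_one, blockOp_mul] using hR.inner_blockOp_nonneg a)
    hγ hα hη

end BlockOperator

section Average

/-- Averaging a function of one coordinate over a finite product gives its marginal average. -/
theorem average_pi_apply {ι : Type*} [Fintype ι] [DecidableEq ι] {κ : ι → Type*}
    [∀ i, Fintype (κ i)] [∀ i, Nonempty (κ i)] (n : ι) (F : κ n → ℝ) :
    (∏ m, (Fintype.card (κ m) : ℝ))⁻¹ * ∑ i : ∀ m, κ m, F (i n)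
      = (Fintype.card (κ n) : ℝ)⁻¹ * ∑ j, F j := by
  have hsum : ∑ i : ∀ m, κ m, F (i n)
      = (∏ m ∈ Finset.univ.erase n, (Fintype.card (κ m) : ℝ)) * ∑ j, F j := by
    have h := Finset.prod_univ_sum (fun m => (Finset.univ : Finset (κ m)))
      (fun m j => if h : m = n then F (h ▸ j) else (1 : ℝ))
    rw [Fintype.piFinset_univ] at h
    have hl : ∀ i : ∀ m, κ m, (∏ m, if h : m = n then F (h ▸ i m) else (1 : ℝ)) = F (i n) := by
      intro i
      rw [Finset.prod_eq_single n (fun m _ hm => dif_neg hm) (by simp)]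
      simp
    simp only [hl] at h
    rw [← h, ← Finset.prod_erase_mul _ _ (Finset.mem_univ n)]
    congr 1
    · refine Finset.prod_congr rfl fun m hm => ?_
      simp [Finset.ne_of_mem_erase hm]
    · simp
  have hne : (∏ m ∈ Finset.univ.erase n, (Fintype.card (κ m) : ℝ)) ≠ 0 :=
    Finset.prod_ne_zero_iff.2 fun m _ => by simp
  rw [hsum, ← Finset.prod_erase_mul _ _ (Finset.mem_univ n), mul_inv]
  field_simp

variable {E : Type*} [NormedAddCommGroup E] [InnerProductSpace ℝ E]

/-- The mean square of a control-variate estimator, bounded by the mean squares of its parts. -/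
theorem average_norm_sub_add_average_sq_le {κ : Type*} [Fintype κ] [Nonempty κ] (X Y : κ → E) :
    (Fintype.card κ : ℝ)⁻¹ * ∑ j, ‖X j - Y j + (Fintype.card κ : ℝ)⁻¹ • ∑ i, Y i‖ ^ 2
      ≤ 2 * ((Fintype.card κ : ℝ)⁻¹ * ∑ j, ‖X j‖ ^ 2)
        + 2 * ((Fintype.card κ : ℝ)⁻¹ * ∑ j, ‖Y j‖ ^ 2)
        - ‖(Fintype.card κ : ℝ)⁻¹ • ∑ j, X j‖ ^ 2 := by
  set r := (Fintype.card κ : ℝ)⁻¹ with hr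
  set mX := r • ∑ j, X j with hmX
  set mY := r • ∑ j, Y j with hmY
  have hr0 : 0 ≤ r := by positivity
  have hrc : r * Fintype.card κ = 1 := inv_mul_cancel₀ (by simp)
  have hvar (Z : κ → E) (w : E) : r * ∑ j, ‖Z j - w‖ ^ 2
      = r * ∑ j, ‖Z j‖ ^ 2 - 2 * ⟪r • ∑ j, Z j, w⟫ + ‖w‖ ^ 2 := by
    simp only [norm_sub_sq_real, Finset.sum_add_distrib, Finset.sum_sub_distrib, ← Finset.mul_sum,
      ← sum_inner, real_inner_smul_left, Finset.sum_const, Finset.card_univ, nsmul_eq_mul]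
    linear_combination ‖w‖ ^ 2 * hrc
  have hX := hvar X mX
  have hY := hvar Y mY
  have hXY := hvar (fun j => X j - Y j + mY) mX
  have hmean : r • ∑ j, (X j - Y j + mY) = mX := by
    rw [Finset.sum_add_distrib, Finset.sum_sub_distrib, smul_add, smul_sub, ← hmX, ← hmY,
      Finset.sum_const, Finset.card_univ, ← Nat.cast_smul_eq_nsmul ℝ, smul_smul, hrc, one_smul]
    abel
  rw [← hmX, real_inner_self_eq_norm_sq] at hX
  rw [← hmY, real_inner_self_eq_norm_sq] at hY
  rw [hmean, real_inner_self_eq_norm_sq] at hXY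
  have hpt : r * ∑ j, ‖X j - Y j + mY - mX‖ ^ 2
      ≤ r * ∑ j, (2 * ‖X j - mX‖ ^ 2 + 2 * ‖Y j - mY‖ ^ 2) := by
    refine mul_le_mul_of_nonneg_left (Finset.sum_le_sum fun j _ => ?_) hr0
    have h1 : X j - Y j + mY - mX = (X j - mX) - (Y j - mY) := by abel
    have h2 := parallelogram_law_with_norm ℝ (X j - mX) (Y j - mY)
    rw [h1]
    nlinarith [mul_self_nonneg ‖X j - mX + (Y j - mY)‖]
  rw [Finset.sum_add_distrib, ← Finset.mul_sum, ← Finset.mul_sum] at hpt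
  have := sq_nonneg ‖mY‖
  linarith

/-- Overwriting a uniformly random entry of a table by a common value, on average. -/
theorem average_sum_update {κ β : Type*} [Fintype κ] [DecidableEq κ] [Nonempty κ]
    (F : κ → β → ℝ) (y : κ → β) (b : β) :
    (Fintype.card κ : ℝ)⁻¹ * ∑ j, ∑ i, F i (Function.update y j b i)
      = (1 - (Fintype.card κ : ℝ)⁻¹) * ∑ i, F i (y i) + (Fintype.card κ : ℝ)⁻¹ * ∑ i, F i b := by
  have hj (j : κ) : ∑ i, F i (Function.update y j b i) = ∑ i, F i (y i) - F j (y j) + F j b := by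
    rw [← Finset.sum_erase_add _ _ (Finset.mem_univ j),
      ← Finset.sum_erase_add (a := j) _ (fun i => F i (y i)) (Finset.mem_univ j),
      Function.update_self, Finset.sum_congr rfl fun i hi =>
        by rw [Function.update_of_ne (Finset.ne_of_mem_erase hi)]]
    ring
  have hc : (Fintype.card κ : ℝ)⁻¹ * Fintype.card κ = 1 := inv_mul_cancel₀ (by simp)
  simp only [hj, Finset.sum_add_distrib, Finset.sum_sub_distrib, Finset.sum_const,
    Finset.card_univ, nsmul_eq_mul]
  linear_combination (∑ i, F i (y i)) * hc

end Average

section FiniteSum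

variable {κ E : Type*} [Fintype κ] [NormedAddCommGroup E] [InnerProductSpace ℝ E]
  [CompleteSpace E] {g : κ → E → ℝ} {μ L : ℝ}

theorem gradient_const_mul_sum (hdiff : ∀ i, Differentiable ℝ (g i)) (r : ℝ) (w : E) :
    gradient (fun w => r * ∑ i, g i w) w = r • ∑ i, gradient (g i) w := by
  apply HasGradientAt.gradient
  rw [hasGradientAt_iff_hasFDerivAt, map_smulₛₗ, map_sum]
  simp only [toDual_gradient]
  exact (HasFDerivAt.fun_sum fun i _ => (hdiff i w).hasFDerivAt).const_mul r

theorem le_inner_average_gradient_sub (hdiff : ∀ i, Differentiable ℝ (g i))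
    (hsc : ∀ i, StrongConvexOn Set.univ μ (g i)) [Nonempty κ] (a b : E) :
    (Fintype.card κ : ℝ)⁻¹ * ∑ i, bregman (g i) a b + μ / 2 * ‖a - b‖ ^ 2
      ≤ ⟪a - b, (Fintype.card κ : ℝ)⁻¹ • ∑ i, (gradient (g i) a - gradient (g i) b)⟫ := by
  have hc : (Fintype.card κ : ℝ)⁻¹ * Fintype.card κ = 1 := inv_mul_cancel₀ (by simp)
  have h : ∑ i, (bregman (g i) a b + μ / 2 * ‖a - b‖ ^ 2)
      ≤ ∑ i, ⟪a - b, gradient (g i) a - gradient (g i) b⟫ := by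
    refine Finset.sum_le_sum fun i _ => ?_
    rw [real_inner_comm, inner_gradient_sub_gradient, norm_sub_rev]
    linarith [(hsc i).le_bregman (hdiff i) b a]
  have h' := mul_le_mul_of_nonneg_left h (by positivity : 0 ≤ (Fintype.card κ : ℝ)⁻¹)
  rw [Finset.sum_add_distrib, Finset.sum_const, Finset.card_univ, nsmul_eq_mul, mul_add,
    ← mul_assoc, hc, one_mul] at h'
  rwa [real_inner_smul_right, inner_sum]

theorem average_bregman_le [Nonempty κ] (hdiff : ∀ i, Differentiable ℝ (g i))
    (hlip : ∀ i a b, ‖gradient (g i) a - gradient (g i) b‖ ≤ L * ‖a - b‖) (a b : E) :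
    (Fintype.card κ : ℝ)⁻¹ * ∑ i, bregman (g i) a b ≤ L / 2 * ‖a - b‖ ^ 2 := by
  refine (inv_mul_le_iff₀ (by simp [Fintype.card_pos])).2 ?_
  refine (Finset.sum_le_card_nsmul _ _ _ fun i _ =>
    bregman_le_of_lipschitz_gradient (hdiff i) (hlip i) a b).trans_eq ?_
  rw [Finset.card_univ, nsmul_eq_mul]

theorem le_average_bregman [Nonempty κ] (hdiff : ∀ i, Differentiable ℝ (g i))
    (hsc : ∀ i, StrongConvexOn Set.univ μ (g i)) (a b : E) :
    μ / 2 * ‖a - b‖ ^ 2 ≤ (Fintype.card κ : ℝ)⁻¹ * ∑ i, bregman (g i) a b := by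
  refine (le_inv_mul_iff₀ (by simp [Fintype.card_pos])).2 ?_
  refine le_trans (Eq.le ?_) (Finset.card_nsmul_le_sum _ _ _ fun i _ =>
    (hsc i).le_bregman (hdiff i) a b)
  rw [Finset.card_univ, nsmul_eq_mul]

/-- Second-moment bound for the stochastic averaging gradient at one node. -/
theorem average_norm_sq_gradient_estimator_le [Nonempty κ] (hμ : 0 < μ) (hL : 0 < L)
    (hdiff : ∀ i, Differentiable ℝ (g i)) (hsc : ∀ i, StrongConvexOn Set.univ μ (g i))
    (hlip : ∀ i a b, ‖gradient (g i) a - gradient (g i) b‖ ≤ L * ‖a - b‖) (a b : E) (y : κ → E) :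
    (Fintype.card κ : ℝ)⁻¹ * ∑ j, ‖(gradient (g j) a - gradient (g j) b)
        - (gradient (g j) (y j) - gradient (g j) b)
        + (Fintype.card κ : ℝ)⁻¹ • ∑ i, (gradient (g i) (y i) - gradient (g i) b)‖ ^ 2
      ≤ 4 * L * ((Fintype.card κ : ℝ)⁻¹ * ∑ i, bregman (g i) (y i) b)
        + (4 * L - 2 * μ) * ((Fintype.card κ : ℝ)⁻¹ * ∑ i, bregman (g i) a b) := by
  refine (average_norm_sub_add_average_sq_le _ _).trans ?_
  have hr : 0 ≤ (Fintype.card κ : ℝ)⁻¹ := by positivity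
  have hco (z : κ → E) : (Fintype.card κ : ℝ)⁻¹ * ∑ j, ‖gradient (g j) (z j) - gradient (g j) b‖ ^ 2
      ≤ 2 * L * ((Fintype.card κ : ℝ)⁻¹ * ∑ j, bregman (g j) (z j) b) := by
    rw [mul_left_comm (2 * L), Finset.mul_sum (a := 2 * L)]
    exact mul_le_mul_of_nonneg_left (Finset.sum_le_sum fun j _ => norm_gradient_sub_sq_le hL
      (hdiff j) (fun u w => le_trans (by positivity) ((hsc j).le_bregman (hdiff j) u w))
      (hlip j) _ _) hr
  have hx := hco fun _ => a
  have hy := hco y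
  have hin := le_inner_average_gradient_sub hdiff hsc a b
  set m := (Fintype.card κ : ℝ)⁻¹ • ∑ i, (gradient (g i) a - gradient (g i) b)
  have hsq : 0 ≤ ‖m - μ • (a - b)‖ ^ 2 := by positivity
  rw [norm_sub_sq_real, real_inner_smul_right, norm_smul μ, mul_pow, Real.norm_eq_abs, sq_abs,
    real_inner_comm] at hsq
  have := mul_le_mul_of_nonneg_left hin (by positivity : 0 ≤ 2 * μ)
  linarith

end FiniteSum

section JointAverage

/-- The average over all joint index choices. -/
noncomputable def jointAvg {N : ℕ} {q : Fin N → ℕ} (φ : (∀ n, Fin (q n)) → ℝ) : ℝ :=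
  (∏ n, (q n : ℝ))⁻¹ * ∑ i, φ i

variable {N : ℕ} {q : Fin N → ℕ}

theorem jointAvg_mono {φ ψ : (∀ n, Fin (q n)) → ℝ} (h : ∀ i, φ i ≤ ψ i) :
    jointAvg φ ≤ jointAvg ψ :=
  mul_le_mul_of_nonneg_left (Finset.sum_le_sum fun i _ => h i) (by positivity)

theorem jointAvg_add (φ ψ : (∀ n, Fin (q n)) → ℝ) :
    jointAvg (fun i => φ i + ψ i) = jointAvg φ + jointAvg ψ := by
  simp only [jointAvg, Finset.sum_add_distrib, mul_add]

theorem jointAvg_const_mul (r : ℝ) (φ : (∀ n, Fin (q n)) → ℝ) :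
    jointAvg (fun i => r * φ i) = r * jointAvg φ := by
  simp only [jointAvg, ← Finset.mul_sum]
  ring

theorem jointAvg_const (hq : ∀ n, 0 < q n) (r : ℝ) :
    jointAvg (fun _ : ∀ n, Fin (q n) => r) = r := by
  have h : (∏ n, (q n : ℝ)) ≠ 0 := Finset.prod_ne_zero_iff.2 fun n _ => by
    exact_mod_cast (hq n).ne'
  simp [jointAvg, h]

theorem jointAvg_sum_apply (hq : ∀ n, 0 < q n) (F : ∀ n, Fin (q n) → ℝ) :
    jointAvg (fun i => ∑ n, F n (i n)) = ∑ n, (q n : ℝ)⁻¹ * ∑ j, F n j := by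
  have : ∀ n, Nonempty (Fin (q n)) := fun n => ⟨⟨0, hq n⟩⟩
  rw [jointAvg, Finset.sum_comm, Finset.mul_sum]
  refine Finset.sum_congr rfl fun n _ => ?_
  have h := average_pi_apply (κ := fun m => Fin (q m)) n (F n)
  simp only [Fintype.card_fin] at h
  exact h

end JointAverage

section DSA

variable {N p : ℕ} {q : Fin N → ℕ} {f : (n : Fin N) → Fin (q n) → Evec p → ℝ}

theorem gradient_locf (hdiff : ∀ n i, Differentiable ℝ (f n i)) (n : Fin N) (w : Evec p) :
    gradient (locf f n) w = (q n : ℝ)⁻¹ • ∑ i, gradient (f n i) w := by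
  exact gradient_const_mul_sum (hdiff n) _ w

theorem ptbl_eq_sum_bregman (xstar : Evec p) (y : (n : Fin N) → Fin (q n) → Evec p) :
    ptbl f xstar y = ∑ n, (q n : ℝ)⁻¹ * ∑ i, bregman (f n i) (y n i) xstar := rfl

theorem hatg_sub_gradient_locf (hdiff : ∀ n i, Differentiable ℝ (f n i)) (xstar : Evec p)
    (x : Fin N → Evec p) (y : (n : Fin N) → Fin (q n) → Evec p) (n : Fin N) (j : Fin (q n)) :
    hatg f x y n j - gradient (locf f n) xstar
      = (gradient (f n j) (x n) - gradient (f n j) xstar)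
        - (gradient (f n j) (y n j) - gradient (f n j) xstar)
        + (q n : ℝ)⁻¹ • ∑ i, (gradient (f n i) (y n i) - gradient (f n i) xstar) := by
  rw [hatg, gradient_locf hdiff, Finset.sum_sub_distrib, smul_sub]
  abel

theorem average_hatg_sub_gradient_locf (hq : ∀ n, 0 < q n)
    (hdiff : ∀ n i, Differentiable ℝ (f n i)) (xstar : Evec p)
    (x : Fin N → Evec p) (y : (n : Fin N) → Fin (q n) → Evec p) (n : Fin N) :
    (q n : ℝ)⁻¹ • ∑ j, (hatg f x y n j - gradient (locf f n) xstar)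
      = (q n : ℝ)⁻¹ • ∑ j, (gradient (f n j) (x n) - gradient (f n j) xstar) := by
  have hc : (q n : ℝ) * (q n : ℝ)⁻¹ = 1 := mul_inv_cancel₀ (by exact_mod_cast (hq n).ne')
  simp only [hatg_sub_gradient_locf hdiff]
  rw [Finset.sum_add_distrib, Finset.sum_sub_distrib, Finset.sum_const, Finset.card_univ,
    Fintype.card_fin, ← Nat.cast_smul_eq_nsmul ℝ, smul_smul, hc, one_smul, sub_add_cancel]

theorem jointAvg_ptbl_tblUpd_le {qmin qmax : ℕ} (hq : ∀ n, 0 < q n) (hqmin : 0 < qmin)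
    (hmin : ∀ n, qmin ≤ q n) (hmax : ∀ n, q n ≤ qmax) (xstar : Evec p)
    (hnonneg : ∀ n i a, 0 ≤ bregman (f n i) a xstar)
    (x : Fin N → Evec p) (y : (n : Fin N) → Fin (q n) → Evec p) :
    jointAvg (fun i => ptbl f xstar (tblUpd x y i))
      ≤ (1 - (qmax : ℝ)⁻¹) * ptbl f xstar y + (qmin : ℝ)⁻¹ * ptbl f xstar fun n _ => x n := by
  have : ∀ n, Nonempty (Fin (q n)) := fun n => ⟨⟨0, hq n⟩⟩
  simp only [ptbl_eq_sum_bregman, tblUpd]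
  rw [jointAvg_sum_apply hq fun n j => (q n : ℝ)⁻¹ *
    ∑ i, bregman (f n i) (Function.update (y n) j (x n) i) xstar, Finset.mul_sum, Finset.mul_sum,
    ← Finset.sum_add_distrib]
  refine Finset.sum_le_sum fun n _ => ?_
  have h := average_sum_update (fun i a => bregman (f n i) a xstar) (y n) (x n)
  rw [Fintype.card_fin] at h
  rw [← Finset.mul_sum, h, mul_add, mul_left_comm, mul_left_comm ((q n : ℝ)⁻¹) ((q n : ℝ)⁻¹)]
  have hqn : (0 : ℝ) < q n := by exact_mod_cast hq n
  have h1 : (qmax : ℝ)⁻¹ ≤ (q n : ℝ)⁻¹ := inv_anti₀ hqn (by exact_mod_cast hmax n)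
  have h2 : (q n : ℝ)⁻¹ ≤ (qmin : ℝ)⁻¹ :=
    inv_anti₀ (by exact_mod_cast hqmin) (by exact_mod_cast hmin n)
  have h3 (z : Fin (q n) → Evec p) : 0 ≤ (q n : ℝ)⁻¹ * ∑ i, bregman (f n i) (z i) xstar :=
    mul_nonneg (by positivity) (Finset.sum_nonneg fun i _ => hnonneg n i _)
  exact add_le_add (mul_le_mul_of_nonneg_right (by linarith) (h3 _))
    (mul_le_mul_of_nonneg_right h2 (h3 _))

theorem jointAvg_norm_sq_hatg_sub_le {μ L : ℝ} (hq : ∀ n, 0 < q n) (hμ : 0 < μ) (hL : 0 < L)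
    (hdiff : ∀ n i, Differentiable ℝ (f n i)) (hsc : ∀ n i, StrongConvexOn Set.univ μ (f n i))
    (hlip : ∀ n i a b, ‖gradient (f n i) a - gradient (f n i) b‖ ≤ L * ‖a - b‖)
    (xstar : Evec p) (x : Fin N → Evec p) (y : (n : Fin N) → Fin (q n) → Evec p) :
    jointAvg (fun i => ∑ n, ‖hatg f x y n (i n) - gradient (locf f n) xstar‖ ^ 2)
      ≤ 4 * L * ptbl f xstar y + (4 * L - 2 * μ) * ptbl f xstar fun n _ => x n := by
  have : ∀ n, Nonempty (Fin (q n)) := fun n => ⟨⟨0, hq n⟩⟩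
  rw [jointAvg_sum_apply hq fun n j => ‖hatg f x y n j - gradient (locf f n) xstar‖ ^ 2,
    ptbl_eq_sum_bregman, ptbl_eq_sum_bregman, Finset.mul_sum, Finset.mul_sum,
    ← Finset.sum_add_distrib]
  refine Finset.sum_le_sum fun n _ => ?_
  simpa only [hatg_sub_gradient_locf hdiff, Fintype.card_fin] using
    average_norm_sq_gradient_estimator_le hμ hL (hdiff n) (hsc n) (hlip n) (x n) xstar (y n)

theorem mul_ptbl_le_jointAvg_inner {μ L : ℝ} (hq : ∀ n, 0 < q n) (hμ : 0 < μ) (hμL : μ ≤ L)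
    (hdiff : ∀ n i, Differentiable ℝ (f n i)) (hsc : ∀ n i, StrongConvexOn Set.univ μ (f n i))
    (hlip : ∀ n i a b, ‖gradient (f n i) a - gradient (f n i) b‖ ≤ L * ‖a - b‖)
    (xstar : Evec p) (x : Fin N → Evec p) (y : (n : Fin N) → Fin (q n) → Evec p) :
    2 * μ / L * ptbl f xstar (fun n _ => x n)
      ≤ jointAvg fun i => ∑ n, ⟪x n - xstar, hatg f x y n (i n) - gradient (locf f n) xstar⟫ := by
  have : ∀ n, Nonempty (Fin (q n)) := fun n => ⟨⟨0, hq n⟩⟩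
  have hL : 0 < L := hμ.trans_le hμL
  rw [jointAvg_sum_apply hq fun n j => ⟪x n - xstar, hatg f x y n j - gradient (locf f n) xstar⟫,
    ptbl_eq_sum_bregman, Finset.mul_sum]
  refine Finset.sum_le_sum fun n _ => ?_
  rw [← inner_sum, ← real_inner_smul_right, average_hatg_sub_gradient_locf hq hdiff]
  have h1 := le_inner_average_gradient_sub (hdiff n) (hsc n) (x n) xstar
  have h2 := average_bregman_le (hdiff n) (hlip n) (x n) xstar
  have h3 := le_average_bregman (hdiff n) (hsc n) (x n) xstar
  rw [Fintype.card_fin] at h1 h2 h3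
  refine le_trans ?_ h1
  set D := (q n : ℝ)⁻¹ * ∑ i, bregman (f n i) (x n) xstar
  have hD : 0 ≤ D := le_trans (by positivity) h3
  have hr : μ / L ≤ 1 := (div_le_one hL).2 hμL
  have h4 : μ / L * D ≤ μ / L * (L / 2 * ‖x n - xstar‖ ^ 2) :=
    mul_le_mul_of_nonneg_left h2 (by positivity)
  have h5 : μ / L * (L / 2 * ‖x n - xstar‖ ^ 2) = μ / 2 * ‖x n - xstar‖ ^ 2 := by field_simp
  have h6 := mul_le_mul_of_nonneg_right hr hD
  have h7 : 2 * μ / L * D = μ / L * D + μ / L * D := by ring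
  linarith

theorem sum_norm_sq_sub_le_ptbl {μ : ℝ} (hq : ∀ n, 0 < q n) (hμ : 0 < μ)
    (hdiff : ∀ n i, Differentiable ℝ (f n i)) (hsc : ∀ n i, StrongConvexOn Set.univ μ (f n i))
    (xstar : Evec p) (x : Fin N → Evec p) :
    ∑ n, ‖x n - xstar‖ ^ 2 ≤ 2 / μ * ptbl f xstar fun n _ => x n := by
  have : ∀ n, Nonempty (Fin (q n)) := fun n => ⟨⟨0, hq n⟩⟩
  rw [ptbl_eq_sum_bregman, Finset.mul_sum]
  refine Finset.sum_le_sum fun n _ => ?_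
  have h := le_average_bregman (hdiff n) (hsc n) (x n) xstar
  rw [Fintype.card_fin] at h
  refine le_trans (Eq.le ?_) (mul_le_mul_of_nonneg_left h (by positivity : 0 ≤ 2 / μ))
  field_simp

theorem quadForm_eq_inner (M : Matrix (Fin N) (Fin N) ℝ) (a : Fin N → Evec p) :
    quadForm M a = ⟪WithLp.toLp 2 a, blockOp M (WithLp.toLp 2 a)⟫ := by
  simp [quadForm, PiLp.inner_apply]

theorem inner_toLp_eq_sum (a b : Fin N → Evec p) :
    ⟪WithLp.toLp 2 a, WithLp.toLp 2 b⟫ = ∑ n, ⟪a n, b n⟫ :=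
  PiLp.inner_apply _ _

theorem sqnormB_eq_norm_sq (a : Fin N → Evec p) : sqnormB a = ‖WithLp.toLp 2 a‖ ^ 2 := by
  simp [sqnormB, PiLp.norm_sq_eq_of_L2]

end DSA

theorem exists_pos_lt_one_mul_le {a₁ a₂ a₃ : ℝ} (h₁ : 0 < a₁) (h₂ : 0 < a₂) (h₃ : 0 < a₃)
    (b₁ b₂ b₃ : ℝ) : ∃ δ : ℝ, 0 < δ ∧ δ < 1 ∧ δ * b₁ ≤ a₁ ∧ δ * b₂ ≤ a₂ ∧ δ * b₃ ≤ a₃ := by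
  have hev {a : ℝ} (ha : 0 < a) (b : ℝ) : ∀ᶠ δ in nhdsWithin (0 : ℝ) (Set.Ioi 0), δ * b ≤ a := by
    have ht : Filter.Tendsto (fun δ : ℝ => δ * b) (nhdsWithin 0 (Set.Ioi 0)) (nhds 0) := by
      simpa using ((continuous_mul_const b).tendsto 0).mono_left nhdsWithin_le_nhds
    exact ht.eventually_le_const ha
  have hlt : ∀ᶠ δ in nhdsWithin (0 : ℝ) (Set.Ioi 0), δ ∈ Set.Ioo (0 : ℝ) 1 :=
    Ioo_mem_nhdsGT one_pos
  obtain ⟨δ, hδ, h⟩ := (hlt.and ((hev h₁ b₁).and ((hev h₂ b₂).and (hev h₃ b₃)))).exists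
  exact ⟨δ, hδ.1, hδ.2, h⟩

/-- **Theorem 5 of the DSA paper (one-step linear contraction).**
Under Assumption 1 on the weight matrices (given blockwise through the `N × N`
factors `W`, `W̃`, `Us = (W̃ − W)^{1/2}`), strong convexity / Lipschitz-gradient
assumptions on the instantaneous local functions, with `γ` the smallest
eigenvalue of `Z̃`, `η > L²q_max/(μ q_min) + L²/μ − L`,
`α ∈ (0, γ/(2η))` and `c ∈ (4αLq_max/η, 4αμq_min/L − 2αq_min(2L−μ)/η)`, there is
a constant `δ ∈ (0,1)`, independent of the iterates `x`, `v` and the table `y`,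
such that the one-step DSA update (with `v` and `v*` in the column space of `U`)
contracts the Lyapunov function:
`E_i[‖u⁺(i) − u*‖²_G + c p(y⁺(i))] ≤ (1 − δ)(‖u − u*‖²_G + c p(y))`. -/
theorem dsa_theorem5_linear_contraction
    {N p : ℕ} {q : Fin N → ℕ} (hq : ∀ n, 0 < q n)
    (qmin qmax : ℕ)
    (hqmin₁ : ∀ n, qmin ≤ q n) (hqmin₂ : ∃ n, q n = qmin)
    (hqmax₁ : ∀ n, q n ≤ qmax) (hqmax₂ : ∃ n, q n = qmax)
    (μ L : ℝ) (hμ : 0 < μ) (hμL : μ ≤ L)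
    (f : (n : Fin N) → Fin (q n) → Evec p → ℝ)
    (hdiff : ∀ n i, Differentiable ℝ (f n i))
    (hsc : ∀ n i, StrongConvexOn Set.univ μ (f n i))
    (hlip : ∀ n i a b, ‖gradient (f n i) a - gradient (f n i) b‖ ≤ L * ‖a - b‖)
    (W Wt Us : Matrix (Fin N) (Fin N) ℝ)
    (hWsym : W.IsSymm) (hWtsym : Wt.IsSymm)
    (hnullW : ∀ v : Fin N → ℝ,
      ((1 : Matrix (Fin N) (Fin N) ℝ) - W).mulVec v = 0 ↔ ∃ c : ℝ, v = fun _ => c)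
    (hnulldiff : ∀ v : Fin N → ℝ, (Wt - W).mulVec v = 0 ↔ ∃ c : ℝ, v = fun _ => c)
    (hnullWt : ((1 : Matrix (Fin N) (Fin N) ℝ) - Wt).mulVec (fun _ => (1:ℝ)) = 0)
    (hord1 : (Wt - W).PosSemidef)
    (hord2 : ((1 : Matrix (Fin N) (Fin N) ℝ) + W - (2:ℝ) • Wt).PosSemidef)
    (hWtpos : Wt.PosDef)
    (hUs : Us.PosSemidef) (hUs2 : Us * Us = Wt - W)
    (γ : ℝ)
    (hγ : ∀ w : Fin N → Evec p, γ * sqnormB w ≤ quadForm Wt w)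
    (hγach : ∃ w : Fin N → Evec p, w ≠ 0 ∧ quadForm Wt w = γ * sqnormB w)
    (η α c : ℝ)
    (hη : L^2 * qmax / (μ * qmin) + L^2 / μ - L < η)
    (hα0 : 0 < α) (hα1 : α < γ / (2 * η))
    (hc0 : 4 * α * L * qmax / η < c)
    (hc1 : c < 4 * α * μ * qmin / L - 2 * α * qmin * (2 * L - μ) / η)
    (xstar : Evec p)
    (hxstar : ∀ w, ∑ n, locf f n xstar ≤ ∑ n, locf f n w)
    (vstar : Fin N → Evec p)
    (hvstar : ∀ n, α • gradient (locf f n) xstar + ∑ m, Us n m • vstar m = 0)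
    (hvstarcol : ∃ a : Fin N → Evec p, ∀ n, vstar n = ∑ m, Us n m • a m) :
    ∃ δ : ℝ, 0 < δ ∧ δ < 1 ∧
      ∀ (x v : Fin N → Evec p) (y : (n : Fin N) → Fin (q n) → Evec p),
        (∃ a : Fin N → Evec p, ∀ n, v n = ∑ m, Us n m • a m) →
        ∀ (xp vp : ((n : Fin N) → Fin (q n)) → Fin N → Evec p),
          (∀ i n, xp i n = x n - α • hatg f x y n (i n)
              - (x n - ∑ m, Wt n m • x m) - ∑ m, Us n m • v m) →
          (∀ i n, vp i n = v n + ∑ m, Us n m • xp i m) →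
          (∏ n, (q n : ℝ))⁻¹ * ∑ i : (n : Fin N) → Fin (q n),
              (quadForm Wt (fun n => xp i n - xstar)
                + sqnormB (fun n => vp i n - vstar n)
                + c * ptbl f xstar (tblUpd x y i))
            ≤ (1 - δ) * (quadForm Wt (fun n => x n - xstar)
                + sqnormB (fun n => v n - vstar n) + c * ptbl f xstar y) := by
  have hL : 0 < L := hμ.trans_le hμL
  have hqmin : 0 < qmin := by
    obtain ⟨n, rfl⟩ := hqmin₂
    exact hq n
  have hqmax : 0 < qmax := by
    obtain ⟨n, rfl⟩ := hqmax₂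
    exact hq n
  have hqmin' : (0 : ℝ) < qmin := by exact_mod_cast hqmin
  have hqmax' : (0 : ℝ) < qmax := by exact_mod_cast hqmax
  have hη0 : 0 < η := by
    have h1 : 0 ≤ L ^ 2 * qmax / (μ * qmin) := by positivity
    have h2 : L ≤ L ^ 2 / μ := by
      rw [le_div_iff₀ hμ, sq]
      exact mul_le_mul_of_nonneg_left hμL hL.le
    linarith
  have hgap : 0 < γ - α * η := by
    rw [lt_div_iff₀ (by positivity)] at hα1
    have := mul_pos hα0 hη0
    linarith
  have hc : 0 < c := lt_of_le_of_lt (by positivity) hc0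
  have htable : 0 < c * (qmax : ℝ)⁻¹ - 4 * L * (α / η) := by
    have h : 4 * L * (α / η) = 4 * α * L * qmax / η * (qmax : ℝ)⁻¹ := by field_simp
    rw [h, ← sub_mul]
    exact mul_pos (sub_pos.2 hc0) (inv_pos.2 hqmax')
  have hiter : 0 < 2 * α * (2 * μ / L) - (4 * L - 2 * μ) * (α / η) - c * (qmin : ℝ)⁻¹ := by
    have h : 2 * α * (2 * μ / L) - (4 * L - 2 * μ) * (α / η)
        = (4 * α * μ * qmin / L - 2 * α * qmin * (2 * L - μ) / η) * (qmin : ℝ)⁻¹ := by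
      field_simp
      ring
    rw [h, ← sub_mul]
    exact mul_pos (sub_pos.2 hc1) (inv_pos.2 hqmin')
  have hWtrow (n : Fin N) : ∑ m, Wt n m = 1 := by
    have h := congrFun hnullWt n
    rw [Matrix.sub_mulVec, Matrix.one_mulVec] at h
    simp only [Pi.sub_apply, Pi.zero_apply, Matrix.mulVec, dotProduct, mul_one] at h
    linarith
  have hUsrow (n : Fin N) : ∑ m, Us n m = 0 := by
    have h := (hnulldiff fun _ => 1).2 ⟨1, rfl⟩
    rw [← hUs2] at h
    nth_rw 1 [← hUs.isHermitian.eq] at h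
    rw [Matrix.conjTranspose_mul_self_mulVec_eq_zero] at h
    simpa [Matrix.mulVec, dotProduct] using congrFun h n
  have hR : (1 - Wt - Us * Us).PosSemidef := by
    convert! hord2 using 1
    rw [hUs2, two_smul]
    abel
  obtain ⟨A, B, K, hB, hK, hstep⟩ := exists_blockOp_step_le (E := Evec p) (γ := γ) hWtsym
    hUs.isSymm hR
    (fun a => by
      rw [← sqnormB_eq_norm_sq, ← quadForm_eq_inner]
      exact hγ a.ofLp) hα0 hη0
  obtain ⟨δ, hδ0, hδ1, hδA, hδt, hδx⟩ := exists_pos_lt_one_mul_le hgap htable hiter A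
    (c + 4 * L * K) ((4 * L - 2 * μ) * K + 2 / μ * B)
  refine ⟨δ, hδ0, hδ1, ?_⟩
  rintro x v y ⟨a, ha⟩ xp vp hxp hvp
  obtain ⟨b, hb⟩ := hvstarcol
  have hpt (i : ∀ n, Fin (q n)) := hstep δ hδ0.le hδA
    (WithLp.toLp 2 fun n => x n - xstar) (WithLp.toLp 2 fun n => v n - vstar n)
    (WithLp.toLp 2 fun n => hatg f x y n (i n) - gradient (locf f n) xstar)
    (WithLp.toLp 2 fun n => xp i n - xstar) (WithLp.toLp 2 fun n => vp i n - vstar n)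
    ⟨WithLp.toLp 2 fun n => a n - b n, by
      ext1 n
      simp [ha, hb, smul_sub, Finset.sum_sub_distrib]⟩
    (by
      ext1 n
      have h : ∑ m, Us n m • vstar m = -(α • gradient (locf f n) xstar) :=
        eq_neg_of_add_eq_zero_right (hvstar n)
      simp only [hxp, PiLp.sub_apply, PiLp.smul_apply, blockOp_apply, smul_sub,
        Finset.sum_sub_distrib, ← Finset.sum_smul, hWtrow, one_smul, h]
      abel)
    (by
      ext1 n
      simp only [hvp, PiLp.add_apply, blockOp_apply, smul_sub, Finset.sum_sub_distrib,
        ← Finset.sum_smul, hUsrow, zero_smul]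
      abel)
  simp only [← quadForm_eq_inner, ← sqnormB_eq_norm_sq] at hpt
  simp only [sqnormB, inner_toLp_eq_sum] at hpt ⊢
  have htbl := jointAvg_ptbl_tblUpd_le hq hqmin hqmin₁ hqmax₁ xstar (fun n i u =>
    le_trans (by positivity) ((hsc n i).le_bregman (hdiff n i) u xstar)) x y
  have hvar := jointAvg_norm_sq_hatg_sub_le hq hμ hL hdiff hsc hlip xstar x y
  have hinner := mul_ptbl_le_jointAvg_inner hq hμ hμL hdiff hsc hlip xstar x y
  have hnorm := sum_norm_sq_sub_le_ptbl hq hμ hdiff hsc xstar x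
  have hnonneg (z : (n : Fin N) → Fin (q n) → Evec p) : 0 ≤ ptbl f xstar z :=
    Finset.sum_nonneg fun n _ => mul_nonneg (by positivity) (Finset.sum_nonneg fun i _ =>
      le_trans (by positivity) ((hsc n i).le_bregman (hdiff n i) (z n i) xstar))
  set V := quadForm Wt (fun n => x n - xstar) + ∑ n, ‖v n - vstar n‖ ^ 2
  set S := ∑ n, ‖x n - xstar‖ ^ 2
  have havg := jointAvg_mono (φ := fun i => quadForm Wt (fun n => xp i n - xstar)
      + ∑ n, ‖vp i n - vstar n‖ ^ 2 + c * ptbl f xstar (tblUpd x y i)) (ψ := fun i => ((1 - δ) * V + δ * B * S)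
      + (-(2 * α) * ∑ n, ⟪x n - xstar, hatg f x y n (i n) - gradient (locf f n) xstar⟫
      + ((α / η + δ * K) * ∑ n, ‖hatg f x y n (i n) - gradient (locf f n) xstar‖ ^ 2
      + c * ptbl f xstar (tblUpd x y i)))) fun i => by
    linarith [hpt i]
  refine le_trans havg ?_
  simp only [jointAvg_add, jointAvg_const_mul, jointAvg_const hq]
  have h1 := mul_le_mul_of_nonneg_left htbl hc.le
  have h2 := mul_le_mul_of_nonneg_left hvar (by positivity : 0 ≤ α / η + δ * K)
  have h3 := mul_le_mul_of_nonneg_left hinner (by positivity : 0 ≤ 2 * α)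
  have h4 := mul_le_mul_of_nonneg_left hnorm (by positivity : 0 ≤ δ * B)
  have h5 := mul_le_mul_of_nonneg_right hδt (hnonneg y)
  have h6 := mul_le_mul_of_nonneg_right hδx (hnonneg fun n _ => x n)
  linear_combination h1 + h2 + h3 + h4 + h5 + h6
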